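/- arXiv:2504.10645 — 6 statements merged into one kernel-verified Lean document; each statement's English description precedes it below -/
import Mathlib

section
/- Let d1, d2 ≥ 1 and for i = 1, …, n let D1^(i) ∈ ℝ^{d1×d1} and D2^(i) ∈ ℝ^{d2×d2} be diagonal matrices with strictly positive diagonal entries. Then exp(Σ_{i=1}^n log(D1^(i) ⊗ D2^(i))) = exp(Σ_{i=1}^n log D1^(i)) ⊗ exp(Σ_{i=1}^n log D2^(i)), where log and exp are applied entrywise to the diagonal entries. In particular, the diagonal part of the log-Cholesky Fréchet mean of Kronecker-structured Cholesky factors is itself a Kronecker product of positive diagonal matrices. -/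
open Matrix
open scoped Kronecker

/-- `log` applied entrywise to the diagonal entries, zero off the diagonal. -/
noncomputable def dlog {ι : Type*} [DecidableEq ι] (M : Matrix ι ι ℝ) : Matrix ι ι ℝ :=
  fun i j => if i = j then Real.log (M i j) else 0

/-- `exp` applied entrywise to the diagonal entries, zero off the diagonal. -/
noncomputable def dexp {ι : Type*} [DecidableEq ι] (M : Matrix ι ι ℝ) : Matrix ι ι ℝ :=
  fun i j => if i = j then Real.exp (M i j) else 0

theorem dlog_eq_diagonal {ι : Type*} [DecidableEq ι] (M : Matrix ι ι ℝ) :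
    dlog M = diagonal fun i => Real.log (M i i) := by
  ext i j
  by_cases h : i = j
  · subst h; simp [dlog]
  · simp [dlog, h]

theorem dexp_eq_diagonal {ι : Type*} [DecidableEq ι] (M : Matrix ι ι ℝ) :
    dexp M = diagonal fun i => Real.exp (M i i) := by
  ext i j
  by_cases h : i = j
  · subst h; simp [dexp]
  · simp [dexp, h]

/-- for diagonal matrices with strictly positive diagonal entries,
`exp(Σ log(D1ᵢ ⊗ D2ᵢ)) = exp(Σ log D1ᵢ) ⊗ exp(Σ log D2ᵢ)`, with `log`/`exp` applied
entrywise to the diagonal. -/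
theorem stmt0 (n d1 d2 : ℕ) (hd1 : 1 ≤ d1) (hd2 : 1 ≤ d2)
    (D1 : Fin n → Matrix (Fin d1) (Fin d1) ℝ)
    (D2 : Fin n → Matrix (Fin d2) (Fin d2) ℝ)
    (hdiag1 : ∀ i, (D1 i).IsDiag) (hdiag2 : ∀ i, (D2 i).IsDiag)
    (hpos1 : ∀ i j, 0 < D1 i j j) (hpos2 : ∀ i j, 0 < D2 i j j) :
    dexp (∑ i, dlog ((D1 i) ⊗ₖ (D2 i))) =
      (dexp (∑ i, dlog (D1 i))) ⊗ₖ (dexp (∑ i, dlog (D2 i))) := by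
  simp only [dexp_eq_diagonal, dlog_eq_diagonal, diagonal_kronecker_diagonal, Matrix.sum_apply,
    diagonal_apply_eq, kroneckerMap_apply, ← Real.exp_add, ← Finset.sum_add_distrib,
    Real.log_mul (hpos1 _ _).ne' (hpos2 _ _).ne']
end

section
/- Let d1, d2 ≥ 1 and for i = 1, …, n let L1^(i) ∈ ℝ^{d1×d1} and L2^(i) ∈ ℝ^{d2×d2} be Cholesky factors. Define L† = Σ_{i=1}^n ⌊L1^(i) ⊗ L2^(i)⌋ + exp(Σ_{i=1}^n log 𝔻(L1^(i) ⊗ L2^(i))). Then det L† = exp(Σ_{i=1}^n (d2 · log det L1^(i) + d1 · log det L2^(i))); that is, the determinant of the log-Cholesky Fréchet-mean aggregate is the product over i of (det L1^(i))^{d2} · (det L2^(i))^{d1}. -/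
open Matrix
open scoped Kronecker

/-- The diagonal part `𝔻(M)` of a square matrix. -/
def dpart {ι : Type*} [DecidableEq ι] (M : Matrix ι ι ℝ) : Matrix ι ι ℝ :=
  fun i j => if i = j then M i j else 0

/-- The strictly lower triangular part `⌊M⌋` of a matrix indexed by `Fin d1 × Fin d2`,
with respect to the lexicographic order. -/
def sltK {d1 d2 : ℕ} (M : Matrix (Fin d1 × Fin d2) (Fin d1 × Fin d2) ℝ) :
    Matrix (Fin d1 × Fin d2) (Fin d1 × Fin d2) ℝ :=
  fun p q => if q.1 < p.1 ∨ (q.1 = p.1 ∧ q.2 < p.2) then M p q else 0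

/-- A Cholesky factor: lower triangular with strictly positive diagonal entries. -/
def IsCholesky {d : ℕ} (M : Matrix (Fin d) (Fin d) ℝ) : Prop :=
  (∀ i j : Fin d, i < j → M i j = 0) ∧ ∀ i : Fin d, 0 < M i i

theorem IsCholesky.log_det {d : ℕ} {M : Matrix (Fin d) (Fin d) ℝ} (h : IsCholesky M) :
    Real.log M.det = ∑ i, Real.log (M i i) := by
  rw [det_of_isLowerTriangular M fun i j hij => h.1 i j hij,
    Real.log_prod fun i _ => (h.2 i).ne']

/-- A matrix indexed by a product that is lower triangular in the lexicographic order has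
determinant the product of its diagonal entries. -/
theorem det_of_lex_lowerTriangular {α β R : Type*} [LinearOrder α] [LinearOrder β] [Fintype α]
    [Fintype β] [CommRing R] (M : Matrix (α × β) (α × β) R)
    (h : ∀ p q, p.1 < q.1 ∨ p.1 = q.1 ∧ p.2 < q.2 → M p q = 0) :
    M.det = ∏ p, M p p := by
  rw [← det_submatrix_equiv_self (ofLex : α ×ₗ β ≃ α × β) M,
    det_of_isLowerTriangular (M.submatrix (ofLex : α ×ₗ β ≃ α × β) ofLex)
      fun p q hpq => h _ _ (Prod.Lex.lt_iff.mp hpq)]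
  exact Equiv.prod_comp ofLex fun p => M p p

/-- the determinant of the log-Cholesky Fréchet-mean aggregate
`L† = Σᵢ ⌊L1⁽ⁱ⁾ ⊗ L2⁽ⁱ⁾⌋ + exp(Σᵢ log 𝔻(L1⁽ⁱ⁾ ⊗ L2⁽ⁱ⁾))` equals
`exp(Σᵢ (d2 · log det L1⁽ⁱ⁾ + d1 · log det L2⁽ⁱ⁾))`. -/
theorem stmt2 (n d1 d2 : ℕ) (hd1 : 1 ≤ d1) (hd2 : 1 ≤ d2)
    (L1 : Fin n → Matrix (Fin d1) (Fin d1) ℝ)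
    (L2 : Fin n → Matrix (Fin d2) (Fin d2) ℝ)
    (h1 : ∀ i, IsCholesky (L1 i)) (h2 : ∀ i, IsCholesky (L2 i)) :
    ((∑ i, sltK ((L1 i) ⊗ₖ (L2 i))) +
        dexp (∑ i, dlog (dpart ((L1 i) ⊗ₖ (L2 i))))).det =
      Real.exp (∑ i, ((d2 : ℝ) * Real.log ((L1 i).det) +
        (d1 : ℝ) * Real.log ((L2 i).det))) := by
  rw [det_of_lex_lowerTriangular]
  · have hdiag (p : Fin d1 × Fin d2) :
        ((∑ i, sltK ((L1 i) ⊗ₖ (L2 i))) + dexp (∑ i, dlog (dpart ((L1 i) ⊗ₖ (L2 i))))) p p =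
          Real.exp (∑ i, (Real.log (L1 i p.1 p.1) + Real.log (L2 i p.2 p.2))) := by
      simp [sltK, dexp, dlog, dpart, Matrix.sum_apply,
        Real.log_mul ((h1 _).2 p.1).ne' ((h2 _).2 p.2).ne']
    simp_rw [hdiag]
    rw [← Real.exp_sum, Finset.sum_comm]
    congr 1
    refine Finset.sum_congr rfl fun i _ => ?_
    rw [(h1 i).log_det, (h2 i).log_det, Fintype.sum_prod_type]
    simp [Finset.sum_add_distrib, Finset.mul_sum]
  · intro p q hpq
    have hne : p ≠ q := by
      rintro rfl
      simp at hpq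
    have hnot : ¬(q.1 < p.1 ∨ q.1 = p.1 ∧ q.2 < p.2) := by
      rcases hpq with h | ⟨h, h'⟩
      · simp [h.not_gt, h.ne']
      · simp [h, h'.not_gt]
    simp [Matrix.sum_apply, sltK, dexp, hne, hnot]
end

section
/- Let L1 ∈ ℝ^{d1×d1} and L2 ∈ ℝ^{d2×d2} be lower triangular matrices. Then ‖⌊L1 ⊗ L2⌋‖_F² = ‖⌊L1⌋‖_F² · ‖𝔻(L2)‖_F² + ‖𝔻(L1)‖_F² · ‖⌊L2⌋‖_F² + ‖⌊L1⌋‖_F² · ‖⌊L2⌋‖_F². -/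
open Matrix
open scoped Kronecker

/-- The strictly lower triangular part `⌊M⌋` of a `Fin d`-indexed square matrix. -/
def slt {d : ℕ} (M : Matrix (Fin d) (Fin d) ℝ) : Matrix (Fin d) (Fin d) ℝ :=
  fun i j => if j < i then M i j else 0

/-- The squared Frobenius norm `‖M‖_F² = Σ_{i,j} M[i,j]²`. -/
def frobSq {ι κ : Type*} [Fintype ι] [Fintype κ] (M : Matrix ι κ ℝ) : ℝ :=
  ∑ i, ∑ j, (M i j) ^ 2

/-- The squared Frobenius norm is multiplicative for the Kronecker product. -/
theorem frobSq_kronecker {ι κ μ ν : Type*} [Fintype ι] [Fintype κ] [Fintype μ] [Fintype ν]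
    (A : Matrix ι κ ℝ) (B : Matrix μ ν ℝ) :
    frobSq (A ⊗ₖ B) = frobSq A * frobSq B := by
  simp only [frobSq, Fintype.sum_prod_type, kroneckerMap_apply, mul_pow, Finset.sum_mul_sum]

/-- for lower triangular `L1`, `L2`,
`‖⌊L1 ⊗ L2⌋‖_F² = ‖⌊L1⌋‖_F²·‖𝔻(L2)‖_F² + ‖𝔻(L1)‖_F²·‖⌊L2⌋‖_F² + ‖⌊L1⌋‖_F²·‖⌊L2⌋‖_F²`. -/
theorem stmt4 (d1 d2 : ℕ)
    (L1 : Matrix (Fin d1) (Fin d1) ℝ) (L2 : Matrix (Fin d2) (Fin d2) ℝ)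
    (h1 : ∀ i j : Fin d1, i < j → L1 i j = 0)
    (h2 : ∀ i j : Fin d2, i < j → L2 i j = 0) :
    frobSq (sltK (L1 ⊗ₖ L2)) =
      frobSq (slt L1) * frobSq (dpart L2) + frobSq (dpart L1) * frobSq (slt L2) +
        frobSq (slt L1) * frobSq (slt L2) := by
  simp only [← frobSq_kronecker]
  simp only [frobSq, ← Finset.sum_add_distrib]
  refine Finset.sum_congr rfl fun p _ => Finset.sum_congr rfl fun q _ => ?_
  obtain ⟨i, k⟩ := p
  obtain ⟨j, l⟩ := q
  simp only [sltK, slt, dpart, kroneckerMap_apply]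
  rcases lt_trichotomy i j with hij | rfl | hij
  · simp [h1 i j hij]
  · rcases lt_trichotomy k l with hkl | rfl | hkl
    · simp [h2 k l hkl]
    · simp
    · simp [hkl, hkl.ne']
  · rcases lt_trichotomy k l with hkl | rfl | hkl
    · simp [h2 k l hkl]
    · simp [hij, hij.ne']
    · simp [hij, hkl, hij.ne', hkl.ne']
end

section
/- Let Ψ ∈ ℝ^{d1d2×d1d2} be a matrix whose entry Ψ[d2(r−1)+v, d2(s−1)+w] (for 1 ≤ r,s ≤ d1, 1 ≤ v,w ≤ d2) is zero unless r > s and v > w, and let K = min{d1, d2}². Then there exist strictly lower triangular matrices A_1, …, A_K ∈ ℝ^{d1×d1} and B_1, …, B_K ∈ ℝ^{d2×d2} such that Ψ = Σ_{i=1}^K A_i ⊗ B_i (a Pitsianis–Van Loan-type decomposition of Ψ into Kronecker products of strictly lower triangular factors with zero residual). -/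
open Matrix
open scoped Kronecker

/-- A strictly lower triangular matrix: zero on and above the diagonal. -/
def IsStrictLower {d : ℕ} (M : Matrix (Fin d) (Fin d) ℝ) : Prop :=
  ∀ i j : Fin d, i ≤ j → M i j = 0

/-- Splitting `Ψ` into its blocks writes it as a sum of `d1 ^ 2` Kronecker products, each with a
matrix unit (or zero) as its left factor. -/
theorem exists_eq_sum_kronecker_of_isStrictLower (d1 d2 : ℕ)
    (Ψ : Matrix (Fin d1 × Fin d2) (Fin d1 × Fin d2) ℝ)
    (hΨ : ∀ (r s : Fin d1) (v w : Fin d2), ¬(s < r ∧ w < v) → Ψ (r, v) (s, w) = 0) :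
    ∃ (A : Fin (d1 ^ 2) → Matrix (Fin d1) (Fin d1) ℝ)
      (B : Fin (d1 ^ 2) → Matrix (Fin d2) (Fin d2) ℝ),
      (∀ i, IsStrictLower (A i)) ∧ (∀ i, IsStrictLower (B i)) ∧
      Ψ = ∑ i, (A i) ⊗ₖ (B i) := by
  let e : Fin (d1 ^ 2) ≃ Fin d1 × Fin d1 := (finCongr (sq d1)).trans finProdFinEquiv.symm
  let A (p : Fin d1 × Fin d1) : Matrix (Fin d1) (Fin d1) ℝ :=
    if p.2 < p.1 then Matrix.single p.1 p.2 1 else 0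
  let B (p : Fin d1 × Fin d1) : Matrix (Fin d2) (Fin d2) ℝ :=
    Matrix.of fun v w => Ψ (p.1, v) (p.2, w)
  refine ⟨A ∘ e, B ∘ e, fun i r s hrs => ?_, fun i v w hvw => ?_, ?_⟩
  · by_cases h : (e i).2 < (e i).1
    · have hne : ¬((e i).1 = r ∧ (e i).2 = s) := by
        rintro ⟨rfl, rfl⟩
        exact absurd h hrs.not_gt
      simp [A, h, hne]
    · simp [A, h]
  · exact hΨ _ _ _ _ fun h => absurd h.2 hvw.not_gt
  · have hsum : ∑ i, (A ∘ e) i ⊗ₖ (B ∘ e) i = ∑ p, A p ⊗ₖ B p :=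
      e.sum_comp fun p => A p ⊗ₖ B p
    rw [hsum]
    ext ⟨r, v⟩ ⟨s, w⟩
    rw [Matrix.sum_apply, Finset.sum_eq_single (r, s)]
    · by_cases h : s < r
      · simp [A, B, h]
      · simp [A, h, hΨ r s v w fun h' => h h'.1]
    · rintro ⟨r', s'⟩ - hne
      have hne' : ¬(r' = r ∧ s' = s) := by simpa using hne
      by_cases h : s' < r'
      · simp [A, h, hne']
      · simp [A, h]
    · simp

/-- if `Ψ[(r,v),(s,w)] = 0` unless `r > s` and `v > w`, then `Ψ` admits a
Pitsianis–Van Loan-type decomposition `Ψ = Σ_{i=1}^K A_i ⊗ B_i` with `K = min{d1,d2}²`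
and all `A_i`, `B_i` strictly lower triangular. -/
theorem stmt6 (d1 d2 : ℕ)
    (Ψ : Matrix (Fin d1 × Fin d2) (Fin d1 × Fin d2) ℝ)
    (hΨ : ∀ (r s : Fin d1) (v w : Fin d2), ¬(s < r ∧ w < v) → Ψ (r, v) (s, w) = 0) :
    ∃ (A : Fin ((min d1 d2) ^ 2) → Matrix (Fin d1) (Fin d1) ℝ)
      (B : Fin ((min d1 d2) ^ 2) → Matrix (Fin d2) (Fin d2) ℝ),
      (∀ i, IsStrictLower (A i)) ∧ (∀ i, IsStrictLower (B i)) ∧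
      Ψ = ∑ i, (A i) ⊗ₖ (B i) := by
  rcases le_total d1 d2 with h | h
  · rw [min_eq_left h]
    exact exists_eq_sum_kronecker_of_isStrictLower d1 d2 Ψ hΨ
  · rw [min_eq_right h]
    obtain ⟨B, A, hB, hA, hsum⟩ := exists_eq_sum_kronecker_of_isStrictLower d2 d1
      (Ψ.submatrix Prod.swap Prod.swap) fun v w r s hn => hΨ r s v w fun h' => hn h'.symm
    refine ⟨A, B, hA, hB, ?_⟩
    ext ⟨r, v⟩ ⟨s, w⟩
    have hentry := congrFun (congrFun hsum (v, r)) (w, s)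
    simpa [Matrix.sum_apply, mul_comm] using hentry
end

section
/- Let c > 1. (i) There exists α > 0 satisfying c·exp(−2/α) − 1 − 1/α = 0. (ii) If α > 0 satisfies c·exp(−2/α) − 1 = 1/α, if ψ : (0, ∞) → ℝ is any function satisfying log x − 1/x < ψ(x) < log x − 1/(2x) for all x > 0 (as the digamma function does), and if (α + α²)·(exp(1/α) − 1) < ε, then |α² + α − c·exp(2·ψ(α))| < ε. -/
/-- for `c > 1`, (i) there exists `α > 0` with
`c·exp(−2/α) − 1 − 1/α = 0`; (ii) if `α > 0` satisfies `c·exp(−2/α) − 1 = 1/α`, if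
`ψ` satisfies the digamma bounds `log x − 1/x < ψ(x) < log x − 1/(2x)` on `(0,∞)`, and if
`(α + α²)·(exp(1/α) − 1) < ε`, then `|α² + α − c·exp(2·ψ(α))| < ε`. -/
theorem stmt8 (c : ℝ) (hc : 1 < c) :
    (∃ α : ℝ, 0 < α ∧ c * Real.exp (-2 / α) - 1 - 1 / α = 0) ∧
    (∀ α : ℝ, 0 < α → c * Real.exp (-2 / α) - 1 = 1 / α →
      ∀ ψ : ℝ → ℝ,
        (∀ x : ℝ, 0 < x →
          Real.log x - 1 / x < ψ x ∧ ψ x < Real.log x - 1 / (2 * x)) →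
        ∀ ε : ℝ, (α + α ^ 2) * (Real.exp (1 / α) - 1) < ε →
          |α ^ 2 + α - c * Real.exp (2 * ψ α)| < ε) := by
  constructor
  · have hcont : ContinuousOn (fun t : ℝ => c * Real.exp (-2 * t) - 1 - t) (Set.Icc 0 c) := by
      fun_prop
    have hexp : Real.exp (-2 * c) ≤ 1 := Real.exp_le_one_iff.2 (by linarith)
    have hmem : (0 : ℝ) ∈ Set.Icc (c * Real.exp (-2 * c) - 1 - c)
        (c * Real.exp (-2 * 0) - 1 - 0) := by
      constructor
      · nlinarith
      · simp only [mul_zero, Real.exp_zero]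
        linarith
    obtain ⟨t, ⟨ht0, -⟩, ht⟩ := intermediate_value_Icc' (by linarith) hcont hmem
    simp only at ht
    have htpos : 0 < t := by
      refine lt_of_le_of_ne ht0 ?_
      rintro rfl
      simp only [mul_zero, Real.exp_zero] at ht
      linarith
    exact ⟨t⁻¹, inv_pos.2 htpos, by simpa [div_eq_mul_inv] using ht⟩
  · intro α hα heq ψ hψ ε hε
    obtain ⟨hlow, hupp⟩ := hψ α hα
    have hlog : Real.exp (2 * Real.log α) = α ^ 2 := by
      rw [two_mul, Real.exp_add, Real.exp_log hα, sq]
    have hS : c * (α ^ 2 * Real.exp (-2 / α)) = α ^ 2 + α := by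
      have h : c * Real.exp (-2 / α) = 1 + 1 / α := by linarith
      calc c * (α ^ 2 * Real.exp (-2 / α)) = α ^ 2 * (c * Real.exp (-2 / α)) := by ring
        _ = α ^ 2 + α := by rw [h]; field_simp
    have hlower : α ^ 2 + α < c * Real.exp (2 * ψ α) := by
      rw [← hS, ← hlog, ← Real.exp_add]
      gcongr
      have h : -2 / α = -2 * (1 / α) := by ring
      linarith
    have hupper : c * Real.exp (2 * ψ α) < (α ^ 2 + α) * Real.exp (1 / α) := by
      rw [← hS, ← hlog, mul_assoc, ← Real.exp_add, ← Real.exp_add]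
      gcongr
      have h : -2 / α = -2 * (1 / α) := by ring
      have h' : 1 / (2 * α) = 1 / α / 2 := by field_simp
      linarith
    rw [abs_lt]
    constructor <;> nlinarith
end

section
/- For Cholesky factors L(0), L(1) ∈ ℝ^{d×d}, define the log-Cholesky geodesic L(t), t ∈ [0,1], entrywise by L(t)[x,y] = (1−t)·L(0)[x,y] + t·L(1)[x,y] for x ≠ y (in particular for x > y), and L(t)[x,x] = L(0)[x,x]^{1−t} · L(1)[x,x]^{t}. Then the map (L1, L2) ↦ hᵀ (L1 ⊗ L2)(L1 ⊗ L2)ᵀ h is not geodesically convex under this geodesic structure: there exist dimensions d1, d2, a vector h ∈ ℝ^{d1·d2}, and pairs of Cholesky factors (L1(0), L1(1)) in ℝ^{d1×d1} and (L2(0), L2(1)) in ℝ^{d2×d2} such that the function f(t) = hᵀ (L1(t) ⊗ L2(t)) (L1(t) ⊗ L2(t))ᵀ h fails to satisfy f(t) ≤ (1−t)·f(0) + t·f(1) for some t ∈ [0,1]. -/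
open Matrix
open scoped Kronecker

/-- The log-Cholesky geodesic between two Cholesky factors: linear interpolation of the
off-diagonal entries and geometric interpolation of the diagonal entries. -/
noncomputable def geo {d : ℕ} (L0 L1 : Matrix (Fin d) (Fin d) ℝ) (t : ℝ) :
    Matrix (Fin d) (Fin d) ℝ :=
  fun x y =>
    if x = y then Real.rpow (L0 x x) (1 - t) * Real.rpow (L1 x x) t
    else (1 - t) * L0 x y + t * L1 x y

/-- the quadratic form `hᵀ (L1 ⊗ L2)(L1 ⊗ L2)ᵀ h` is not geodesically convex
along log-Cholesky geodesics: there are dimensions, a vector `h`, Cholesky endpoint pairs and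
`t ∈ [0,1]` for which the convexity inequality fails. -/
theorem stmt12 : ∃ (d1 d2 : ℕ) (h : Fin d1 × Fin d2 → ℝ)
    (L10 L11 : Matrix (Fin d1) (Fin d1) ℝ) (L20 L21 : Matrix (Fin d2) (Fin d2) ℝ),
    IsCholesky L10 ∧ IsCholesky L11 ∧ IsCholesky L20 ∧ IsCholesky L21 ∧
    ∃ t ∈ Set.Icc (0 : ℝ) 1,
      ¬ (dotProduct h
            ((((geo L10 L11 t) ⊗ₖ (geo L20 L21 t)) *
              ((geo L10 L11 t) ⊗ₖ (geo L20 L21 t)).transpose).mulVec h) ≤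
          (1 - t) * dotProduct h
            ((((geo L10 L11 0) ⊗ₖ (geo L20 L21 0)) *
              ((geo L10 L11 0) ⊗ₖ (geo L20 L21 0)).transpose).mulVec h) +
          t * dotProduct h
            ((((geo L10 L11 1) ⊗ₖ (geo L20 L21 1)) *
              ((geo L10 L11 1) ⊗ₖ (geo L20 L21 1)).transpose).mulVec h)) := by
  have four_rpow_half : (4 : ℝ) ^ (1 / 2 : ℝ) = 2 := by
    rw [← Real.sqrt_eq_rpow, show (4 : ℝ) = 2 ^ 2 by norm_num]
    exact Real.sqrt_sq (by norm_num)
  refine ⟨2, 1, fun _ => 1, !![1, 0; -1, 1], !![4, 0; -4, 1], !![1], !![1],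
    ?_, ?_, ?_, ?_, 1 / 2, by norm_num, ?_⟩
  iterate 4
    constructor
    · intro i j hij
      fin_cases i <;> fin_cases j <;> simp at hij ⊢
    · intro i
      fin_cases i <;> simp
  have geo_half : geo !![(1 : ℝ), 0; -1, 1] !![4, 0; -4, 1] (1 / 2) = !![2, 0; -5 / 2, 1] := by
    ext i j
    fin_cases i <;> fin_cases j <;> norm_num [geo, four_rpow_half]
  have geo_zero : geo !![(1 : ℝ), 0; -1, 1] !![4, 0; -4, 1] 0 = !![1, 0; -1, 1] := by
    ext i j
    fin_cases i <;> fin_cases j <;> norm_num [geo]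
  have geo_one : geo !![(1 : ℝ), 0; -1, 1] !![4, 0; -4, 1] 1 = !![4, 0; -4, 1] := by
    ext i j
    fin_cases i <;> fin_cases j <;> norm_num [geo]
  have geo_const (t : ℝ) : geo !![(1 : ℝ)] !![1] t = !![1] := by
    ext i j
    fin_cases i; fin_cases j
    simp [geo]
  rw [geo_half, geo_zero, geo_one, geo_const, geo_const, geo_const]
  norm_num [dotProduct, mulVec, Matrix.mul_apply, Fintype.sum_prod_type, Fin.sum_univ_two]
end
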